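/- arXiv:1907.03825 — 2 statements merged into one kernel-verified Lean document; each statement's English description precedes it below -/
import Mathlib

section
/- Let f : [a,b] → X be strongly McShane integrable on [a,b] and assume that for every t₁ ∈ [a₁,b₁] the section f_{t₁} is strongly McShane integrable on [a₂,b₂] and for every t₂ ∈ [a₂,b₂] the section f_{t₂} is strongly McShane integrable on [a₁,b₁]. Then the function h(t₂) = (M)∫_{[a₁,b₁]} f_{t₂}, t₂ ∈ [a₂,b₂], is strongly McShane integrable on [a₂,b₂] and (M)∫_{[a₂,b₂]} ((M)∫_{[a₁,b₁]} f_{t₂}) = (M)∫_{[a,b]} f. -/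
open Set MeasureTheory

variable {E : Type*} [MeasureSpace E] [PseudoMetricSpace E] [Preorder E]
variable {X : Type*} [NormedAddCommGroup X] [NormedSpace ℝ X]

/-- The closed interval of a tagged item `(t, p, q)` is `[p, q]` (the tag is `t`). -/
def itemBox (x : E × E × E) : Set E := Set.Icc x.2.1 x.2.2

/-- `[p,q]` is a closed non-degenerate subinterval of `K`. -/
def IsSubinterval (K : Set E) (p q : E) : Prop :=
  Set.Icc p q ⊆ K ∧ (interior (Set.Icc p q)).Nonempty

/-- `P` is an `𝓜`-partition of `K`: a finite collection of tagged pairwise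
non-overlapping closed non-degenerate subintervals of `K` covering `K`, with tags in `K`. -/
def IsMPartition (K : Set E) (P : Finset (E × E × E)) : Prop :=
  (∀ x ∈ P, x.1 ∈ K ∧ IsSubinterval K x.2.1 x.2.2) ∧
  (∀ x ∈ P, ∀ y ∈ P, x ≠ y → interior (itemBox x) ∩ interior (itemBox y) = ∅) ∧
  (⋃ x ∈ P, itemBox x) = K

/-- `𝓗𝓚`-partition: an `𝓜`-partition each of whose tags belongs to its interval. -/
def IsHKPartition (K : Set E) (P : Finset (E × E × E)) : Prop :=
  IsMPartition K P ∧ ∀ x ∈ P, x.1 ∈ itemBox x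

/-- A gauge on `K`: positive on `K`. -/
def IsGauge (K : Set E) (δ : E → ℝ) : Prop := ∀ t ∈ K, 0 < δ t

/-- A tagged partition is `δ`-fine if each interval lies in the open ball
around its tag of radius `δ(tag)`. -/
def IsFine (δ : E → ℝ) (P : Finset (E × E × E)) : Prop :=
  ∀ x ∈ P, itemBox x ⊆ Metric.ball x.1 (δ x.1)

/-- `f` is McShane integrable on `K` with integral `v`. -/
def HasMcShaneIntegral (K : Set E) (f : E → X) (v : X) : Prop :=
  ∀ ε > 0, ∃ δ : E → ℝ, IsGauge K δ ∧
    ∀ P : Finset (E × E × E), IsMPartition K P → IsFine δ P →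
      ‖(∑ x ∈ P, (volume (itemBox x)).toReal • f x.1) - v‖ < ε

/-- `f` is Henstock–Kurzweil integrable on `K` with integral `v`. -/
def HasHKIntegral (K : Set E) (f : E → X) (v : X) : Prop :=
  ∀ ε > 0, ∃ δ : E → ℝ, IsGauge K δ ∧
    ∀ P : Finset (E × E × E), IsHKPartition K P → IsFine δ P →
      ‖(∑ x ∈ P, (volume (itemBox x)).toReal • f x.1) - v‖ < ε

/-- An additive interval function on the non-degenerate closed subintervals of `K`
(an interval is recorded by its pair of corners). -/
def IsAdditiveIntervalFun (K : Set E) (F : E × E → X) : Prop :=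
  ∀ p q r s u w : E, IsSubinterval K p q → IsSubinterval K r s → IsSubinterval K u w →
    interior (Set.Icc p q) ∩ interior (Set.Icc r s) = ∅ →
    Set.Icc p q ∪ Set.Icc r s = Set.Icc u w →
    F (u, w) = F (p, q) + F (r, s)

/-- `f` is strongly McShane integrable on `[a,b]` with `(M)∫_{[a,b]} f = v`. -/
def HasStrongMcShaneIntegral (a b : E) (f : E → X) (v : X) : Prop :=
  ∃ F : E × E → X, IsAdditiveIntervalFun (Set.Icc a b) F ∧ F (a, b) = v ∧
    ∀ ε > 0, ∃ δ : E → ℝ, IsGauge (Set.Icc a b) δ ∧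
      ∀ P : Finset (E × E × E), IsMPartition (Set.Icc a b) P → IsFine δ P →
        ∑ x ∈ P, ‖(volume (itemBox x)).toReal • f x.1 - F (x.2.1, x.2.2)‖ < ε

/-- `f` is strongly Henstock–Kurzweil integrable on `[a,b]` with `(HK)∫_{[a,b]} f = v`. -/
def HasStrongHKIntegral (a b : E) (f : E → X) (v : X) : Prop :=
  ∃ F : E × E → X, IsAdditiveIntervalFun (Set.Icc a b) F ∧ F (a, b) = v ∧
    ∀ ε > 0, ∃ δ : E → ℝ, IsGauge (Set.Icc a b) δ ∧
      ∀ P : Finset (E × E × E), IsHKPartition (Set.Icc a b) P → IsFine δ P →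
        ∑ x ∈ P, ‖(volume (itemBox x)).toReal • f x.1 - F (x.2.1, x.2.2)‖ < ε

/-- Property `𝓢*𝓜` on `[a,b]`. -/
def PropSM (a b : E) (f : E → X) : Prop :=
  ∀ ε > 0, ∃ δ : E → ℝ, IsGauge (Set.Icc a b) δ ∧
    ∀ P Q : Finset (E × E × E),
      IsMPartition (Set.Icc a b) P → IsFine δ P →
      IsMPartition (Set.Icc a b) Q → IsFine δ Q →
      ∑ x ∈ P, ∑ y ∈ Q, ‖f x.1 - f y.1‖ * (volume (itemBox x ∩ itemBox y)).toReal < ε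

/-- Property `𝓢*𝓗𝓚` on `[a,b]`. -/
def PropSHK (a b : E) (f : E → X) : Prop :=
  ∀ ε > 0, ∃ δ : E → ℝ, IsGauge (Set.Icc a b) δ ∧
    ∀ P Q : Finset (E × E × E),
      IsHKPartition (Set.Icc a b) P → IsFine δ P →
      IsHKPartition (Set.Icc a b) Q → IsFine δ Q →
      ∑ x ∈ P, ∑ y ∈ Q, ‖f x.1 - f y.1‖ * (volume (itemBox x ∩ itemBox y)).toReal < ε


/-- Cousin's lemma. The partition produced is moreover compatible with every additive function of
the end points. -/
theorem exists_fine_mPartition {G : Type*} [NormedAddCommGroup G]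
    {a b : ℝ} (hab : a < b) {δ : ℝ → ℝ} (hδ : IsGauge (Set.Icc a b) δ) :
    ∃ P : Finset (ℝ × ℝ × ℝ), IsMPartition (Set.Icc a b) P ∧ IsFine δ P ∧
      ∀ φ : ℝ × ℝ → G, (∀ p q r, a ≤ p → p < q → q < r → r ≤ b → φ (p, r) = φ (p, q) + φ (q, r)) →
        ∑ x ∈ P, φ x.2 = φ (a, b) := by
  classical
  obtain ⟨t, ht0, htm, ⟨m, hm⟩, ht⟩ := exists_monotone_Icc_subset_open_cover_Icc hab.le
    (c := fun i : Set.Icc a b => {x : Set.Icc a b | (x : ℝ) ∈ Metric.ball (i : ℝ) (δ i)})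
    (fun i => Metric.isOpen_ball.preimage continuous_subtype_val)
    (fun x _ => Set.mem_iUnion.2 ⟨x, Metric.mem_ball_self (hδ x x.2)⟩)
  have key : ∀ n, a < t n → ∃ P : Finset (ℝ × ℝ × ℝ),
      ((∀ x ∈ P, x.1 ∈ Set.Icc a b ∧ IsSubinterval (Set.Icc a (t n)) x.2.1 x.2.2) ∧
        (∀ x ∈ P, ∀ y ∈ P, x ≠ y → interior (itemBox x) ∩ interior (itemBox y) = ∅) ∧
        (⋃ x ∈ P, itemBox x) = Set.Icc a (t n)) ∧ IsFine δ P ∧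
      ∀ φ : ℝ × ℝ → G, (∀ p q r, a ≤ p → p < q → q < r → r ≤ b → φ (p, r) = φ (p, q) + φ (q, r)) →
        ∑ x ∈ P, φ x.2 = φ (a, t n) := by
    intro n
    induction n with
    | zero => intro h; exact absurd ht0 h.ne'
    | succ n ih =>
      intro hn
      obtain hlt | heq := (show (t n : ℝ) ≤ t (n + 1) from htm n.le_succ).lt_or_eq
      swap
      · rw [← heq] at hn ⊢
        exact ih hn
      obtain ⟨i, hi⟩ := ht n
      have hball : Set.Icc (t n : ℝ) (t (n + 1)) ⊆ Metric.ball (i : ℝ) (δ i) := fun x hx =>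
        @hi ⟨x, (t n).2.1.trans hx.1, hx.2.trans (t (n + 1)).2.2⟩ ⟨hx.1, hx.2⟩
      have hint : (interior (Set.Icc (t n : ℝ) (t (n + 1)))).Nonempty := by
        rw [interior_Icc]; exact Set.nonempty_Ioo.2 hlt
      obtain hna | hna := (t n).2.1.lt_or_eq
      · obtain ⟨P, ⟨hP1, hP2, hP3⟩, hfine, hadd⟩ := ih hna
        have hdisj : ∀ x ∈ P, interior (itemBox x) ∩
            interior (itemBox ((i : ℝ), (t n : ℝ), (t (n + 1) : ℝ))) = ∅ := by
          intro x hx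
          have h1 := interior_mono (hP1 x hx).2.1
          rw [itemBox, itemBox, interior_Icc (a := (t n : ℝ))]
          rw [interior_Icc (a := a)] at h1
          ext z
          simp only [Set.mem_inter_iff, Set.mem_Ioo, Set.mem_empty_iff_false, iff_false, not_and]
          intro hz hz1
          exact absurd ((h1 hz).2.trans hz1) (lt_irrefl _)
        have hnot : ((i : ℝ), (t n : ℝ), (t (n + 1) : ℝ)) ∉ P := by
          intro hmem
          have h1 := hdisj _ hmem
          rw [Set.inter_self] at h1
          exact hint.ne_empty h1
        refine ⟨insert ((i : ℝ), (t n : ℝ), (t (n + 1) : ℝ)) P, ⟨?_, ?_, ?_⟩, ?_, ?_⟩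
        · intro x hx
          obtain rfl | hx := Finset.mem_insert.1 hx
          · exact ⟨i.2, Set.Icc_subset_Icc_left hna.le, hint⟩
          · obtain ⟨h1, h2, h3⟩ := hP1 x hx
            exact ⟨h1, h2.trans (Set.Icc_subset_Icc_right hlt.le), h3⟩
        · intro x hx y hy hxy
          obtain rfl | hx := Finset.mem_insert.1 hx <;> obtain rfl | hy := Finset.mem_insert.1 hy
          · exact absurd rfl hxy
          · rw [Set.inter_comm]; exact hdisj y hy
          · exact hdisj x hx
          · exact hP2 x hx y hy hxy
        · rw [Finset.set_biUnion_insert, hP3, Set.union_comm]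
          exact Set.Icc_union_Icc_eq_Icc hna.le hlt.le
        · intro x hx
          obtain rfl | hx := Finset.mem_insert.1 hx
          · exact hball
          · exact hfine x hx
        · intro φ hφ
          rw [Finset.sum_insert hnot, hadd φ hφ,
            hφ a (t n) (t (n + 1)) le_rfl hna hlt (t (n + 1)).2.2, add_comm]
      · refine ⟨{((i : ℝ), (t n : ℝ), (t (n + 1) : ℝ))}, ⟨?_, ?_, ?_⟩, ?_, ?_⟩
        · intro x hx
          rw [Finset.mem_singleton.1 hx]
          exact ⟨i.2, Set.Icc_subset_Icc_left hna.le, hint⟩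
        · intro x hx y hy hxy
          exact absurd ((Finset.mem_singleton.1 hx).trans (Finset.mem_singleton.1 hy).symm) hxy
        · simp [itemBox, ← hna]
        · intro x hx
          rw [Finset.mem_singleton.1 hx]
          exact hball
        · intro φ _
          rw [Finset.sum_singleton, ← hna]
  have htb : (t m : ℝ) = b := hm m le_rfl
  obtain ⟨P, hP, hfine, hadd⟩ := key m (htb.symm ▸ hab)
  rw [htb] at hP hadd
  exact ⟨P, hP, hfine, hadd⟩

theorem isSubinterval_Icc_iff {a b p q : ℝ} :
    IsSubinterval (Set.Icc a b) p q ↔ a ≤ p ∧ p < q ∧ q ≤ b := by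
  rw [IsSubinterval, interior_Icc, Set.nonempty_Ioo]
  constructor
  · rintro ⟨h1, h2⟩
    rw [Set.Icc_subset_Icc_iff h2.le] at h1
    exact ⟨h1.1, h2, h1.2⟩
  · rintro ⟨h1, h2, h3⟩
    exact ⟨Set.Icc_subset_Icc h1 h3, h2⟩

theorem interior_Icc_prod (p q : ℝ × ℝ) :
    interior (Set.Icc p q) = Set.Ioo p.1 q.1 ×ˢ Set.Ioo p.2 q.2 := by
  rw [Set.Icc_prod_eq, interior_prod_eq, interior_Icc, interior_Icc]

theorem IsSubinterval.prod {a b p q : ℝ × ℝ} (h₁ : IsSubinterval (Set.Icc a.1 b.1) p.1 q.1)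
    (h₂ : IsSubinterval (Set.Icc a.2 b.2) p.2 q.2) : IsSubinterval (Set.Icc a b) p q := by
  refine ⟨?_, ?_⟩
  · rw [Set.Icc_prod_eq, Set.Icc_prod_eq]
    exact Set.prod_mono h₁.1 h₂.1
  · rw [Set.Icc_prod_eq, interior_prod_eq]
    exact h₁.2.prod h₂.2

theorem IsAdditiveIntervalFun.add_adjacent {G : Type*} [NormedAddCommGroup G]
    {a b : ℝ} {F : ℝ × ℝ → G}
    (hF : IsAdditiveIntervalFun (Set.Icc a b) F) {p q r : ℝ} (hp : a ≤ p) (hpq : p < q)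
    (hqr : q < r) (hr : r ≤ b) : F (p, r) = F (p, q) + F (q, r) := by
  refine hF p q q r p r (isSubinterval_Icc_iff.2 ⟨hp, hpq, hqr.le.trans hr⟩)
    (isSubinterval_Icc_iff.2 ⟨hp.trans hpq.le, hqr, hr⟩)
    (isSubinterval_Icc_iff.2 ⟨hp, hpq.trans hqr, hr⟩) ?_
    (Set.Icc_union_Icc_eq_Icc hpq.le hqr.le)
  rw [interior_Icc, interior_Icc, Set.Ioo_inter_Ioo, Set.Ioo_eq_empty]
  simp [hpq.le, hqr.le]

/-- Additivity of an interval function of the plane in the first variable. -/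
theorem IsAdditiveIntervalFun.add_adjacent_fst {G : Type*} [NormedAddCommGroup G]
    {a b : ℝ × ℝ} {F : (ℝ × ℝ) × ℝ × ℝ → G}
    (hF : IsAdditiveIntervalFun (Set.Icc a b) F) {c d : ℝ}
    (hcd : IsSubinterval (Set.Icc a.2 b.2) c d) {p q r : ℝ} (hp : a.1 ≤ p)
    (hpq : p < q) (hqr : q < r) (hr : r ≤ b.1) :
    F ((p, c), (r, d)) = F ((p, c), (q, d)) + F ((q, c), (r, d)) := by
  refine hF _ _ _ _ _ _
    (.prod (isSubinterval_Icc_iff.2 ⟨hp, hpq, hqr.le.trans hr⟩) hcd)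
    (.prod (isSubinterval_Icc_iff.2 ⟨hp.trans hpq.le, hqr, hr⟩) hcd)
    (.prod (isSubinterval_Icc_iff.2 ⟨hp, hpq.trans hqr, hr⟩) hcd) ?_ ?_
  · rw [interior_Icc_prod, interior_Icc_prod, Set.prod_inter_prod, Set.Ioo_inter_Ioo,
      Set.Ioo_eq_empty, Set.empty_prod]
    simp [hpq.le, hqr.le]
  · rw [← Set.Icc_prod_Icc, ← Set.Icc_prod_Icc, ← Set.Icc_prod_Icc, ← Set.union_prod,
      Set.Icc_union_Icc_eq_Icc hpq.le hqr.le]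

/-- An additive interval function of the plane restricts to an additive interval function of the
second variable on full strips. -/
theorem IsAdditiveIntervalFun.strip {G : Type*} [NormedAddCommGroup G]
    {a b : ℝ × ℝ} {F : (ℝ × ℝ) × ℝ × ℝ → G}
    (hF : IsAdditiveIntervalFun (Set.Icc a b) F) (hab : a.1 < b.1) :
    IsAdditiveIntervalFun (Set.Icc a.2 b.2) (fun J : ℝ × ℝ => F ((a.1, J.1), (b.1, J.2))) := by
  intro p q r s u w hpq hrs huw hdisj hunion
  have hI : IsSubinterval (Set.Icc a.1 b.1) a.1 b.1 :=
    isSubinterval_Icc_iff.2 ⟨le_rfl, hab, le_rfl⟩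
  refine hF _ _ _ _ _ _ (.prod hI hpq) (.prod hI hrs) (.prod hI huw) ?_ ?_
  · rw [interior_Icc, interior_Icc] at hdisj
    rw [interior_Icc_prod, interior_Icc_prod, Set.prod_inter_prod, hdisj, Set.prod_empty]
  · rw [← Set.Icc_prod_Icc, ← Set.Icc_prod_Icc, ← Set.Icc_prod_Icc, ← Set.prod_union, hunion]

theorem IsMPartition.sum_volume_le {a b : ℝ} (hab : a ≤ b) {P : Finset (ℝ × ℝ × ℝ)}
    (hP : IsMPartition (Set.Icc a b) P) : ∑ x ∈ P, (volume (itemBox x)).toReal ≤ b - a := by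
  have hvol : ∀ x : ℝ × ℝ × ℝ, volume (itemBox x) = volume (interior (itemBox x)) := fun x => by
    rw [itemBox, interior_Icc, Real.volume_Icc, Real.volume_Ioo]
  have hfin : ∀ x ∈ P, volume (itemBox x) ≠ ⊤ := fun x _ => by
    rw [itemBox, Real.volume_Icc]; exact ENNReal.ofReal_ne_top
  rw [← ENNReal.toReal_sum hfin, ← ENNReal.toReal_ofReal (sub_nonneg.2 hab), ← Real.volume_Icc]
  refine ENNReal.toReal_mono (by rw [Real.volume_Icc]; exact ENNReal.ofReal_ne_top) ?_
  rw [Finset.sum_congr rfl fun x _ => hvol x, ← measure_biUnion_finset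
    (fun x hx y hy hxy => Set.disjoint_iff_inter_eq_empty.2 (hP.2.1 x hx y hy hxy))
    (fun x _ => isOpen_interior.measurableSet)]
  exact measure_mono (Set.iUnion₂_subset fun x hx => interior_subset.trans (hP.1 x hx).2.1)

/-- The product of a tagged interval of the first axis (second component) and one of the second
axis (first component). -/
def itemProd (z : (_ : ℝ × ℝ × ℝ) × (ℝ × ℝ × ℝ)) : (ℝ × ℝ) × (ℝ × ℝ) × (ℝ × ℝ) :=
  ((z.2.1, z.1.1), (z.2.2.1, z.1.2.1), (z.2.2.2, z.1.2.2))

theorem itemProd_injective : Function.Injective itemProd := by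
  rintro ⟨⟨a, b, c⟩, a', b', c'⟩ ⟨⟨d, e, f⟩, d', e', f'⟩ h
  simp only [itemProd, Prod.mk.injEq] at h
  obtain ⟨⟨rfl, rfl⟩, ⟨rfl, rfl⟩, rfl, rfl⟩ := h
  rfl

theorem itemBox_itemProd (z : (_ : ℝ × ℝ × ℝ) × (ℝ × ℝ × ℝ)) :
    itemBox (itemProd z) = itemBox z.2 ×ˢ itemBox z.1 :=
  (Set.Icc_prod_Icc _ _ _ _).symm

theorem volume_itemBox_itemProd (z : (_ : ℝ × ℝ × ℝ) × (ℝ × ℝ × ℝ)) :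
    (volume (itemBox (itemProd z))).toReal =
      (volume (itemBox z.1)).toReal * (volume (itemBox z.2)).toReal := by
  rw [itemBox_itemProd, Measure.volume_eq_prod, Measure.prod_prod, ENNReal.toReal_mul, mul_comm]

open Classical in
/-- Splitting each strip of a partition of the second axis, by a partition of the first axis that
may depend on the strip, gives a partition of the rectangle. -/
theorem IsMPartition.sigma {a b : ℝ × ℝ} {Q : Finset (ℝ × ℝ × ℝ)}
    {P : ℝ × ℝ × ℝ → Finset (ℝ × ℝ × ℝ)} (hQ : IsMPartition (Set.Icc a.2 b.2) Q)
    (hP : ∀ y ∈ Q, IsMPartition (Set.Icc a.1 b.1) (P y)) :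
    IsMPartition (Set.Icc a b) ((Q.sigma P).image itemProd) := by
  refine ⟨?_, ?_, ?_⟩
  · intro x hx
    obtain ⟨⟨y, x⟩, hz, rfl⟩ := Finset.mem_image.1 hx
    obtain ⟨hy, hx⟩ := Finset.mem_sigma.1 hz
    obtain ⟨h1, h2⟩ := hQ.1 y hy
    obtain ⟨h3, h4⟩ := (hP y hy).1 x hx
    refine ⟨?_, .prod h4 h2⟩
    rw [Set.Icc_prod_eq]
    exact ⟨h3, h1⟩
  · intro w hw w' hw' hne
    obtain ⟨⟨y, x⟩, hz, rfl⟩ := Finset.mem_image.1 hw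
    obtain ⟨⟨y', x'⟩, hz', rfl⟩ := Finset.mem_image.1 hw'
    obtain ⟨hy, hx⟩ := Finset.mem_sigma.1 hz
    obtain ⟨hy', hx'⟩ := Finset.mem_sigma.1 hz'
    rw [itemBox_itemProd, itemBox_itemProd, interior_prod_eq, interior_prod_eq,
      Set.prod_inter_prod]
    by_cases h : y = y'
    · subst h
      have hxx : x ≠ x' := fun h => hne (by rw [h])
      rw [(hP y hy).2.1 x hx x' hx' hxx, Set.empty_prod]
    · rw [hQ.2.1 y hy y' hy' h, Set.prod_empty]
  · rw [Set.Icc_prod_eq]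
    refine Set.Subset.antisymm ?_ ?_
    · refine Set.iUnion₂_subset fun w hw => ?_
      obtain ⟨⟨y, x⟩, hz, rfl⟩ := Finset.mem_image.1 hw
      obtain ⟨hy, hx⟩ := Finset.mem_sigma.1 hz
      rw [itemBox_itemProd]
      exact Set.prod_mono ((hP y hy).1 x hx).2.1 (hQ.1 y hy).2.1
    · rintro ⟨s, t⟩ ⟨hs, ht⟩
      simp only at hs ht
      rw [← hQ.2.2] at ht
      obtain ⟨y, hy, hty⟩ := Set.mem_iUnion₂.1 ht
      rw [← (hP y hy).2.2] at hs
      obtain ⟨x, hx, hsx⟩ := Set.mem_iUnion₂.1 hs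
      refine Set.mem_iUnion₂.2 ⟨itemProd ⟨y, x⟩,
        Finset.mem_image_of_mem _ (Finset.mem_sigma.2 ⟨hy, hx⟩), ?_⟩
      rw [itemBox_itemProd]
      exact ⟨hsx, hty⟩

open Classical in
theorem IsFine.sigma {δ : ℝ × ℝ → ℝ} {η : ℝ → ℝ} {Q : Finset (ℝ × ℝ × ℝ)}
    {P : ℝ × ℝ × ℝ → Finset (ℝ × ℝ × ℝ)} (hQ : IsFine η Q)
    (hP : ∀ y ∈ Q, IsFine (fun s => δ (s, y.1)) (P y))
    (hη : ∀ y ∈ Q, ∀ x ∈ P y, η y.1 ≤ δ (x.1, y.1)) :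
    IsFine δ ((Q.sigma P).image itemProd) := by
  intro w hw
  obtain ⟨⟨y, x⟩, hz, rfl⟩ := Finset.mem_image.1 hw
  obtain ⟨hy, hx⟩ := Finset.mem_sigma.1 hz
  rw [itemBox_itemProd]
  change _ ⊆ Metric.ball (x.1, y.1) (δ (x.1, y.1))
  rw [← ball_prod_same]
  exact Set.prod_mono (hP y hy x hx) ((hQ y hy).trans (Metric.ball_subset_ball (hη y hy x hx)))

theorem Finset.exists_pos_forall_le {ι : Type*} (s : Finset ι) (g : ι → ℝ)
    (hg : ∀ i ∈ s, 0 < g i) : ∃ η > 0, ∀ i ∈ s, η ≤ g i := by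
  obtain rfl | hs := s.eq_empty_or_nonempty
  · exact ⟨1, one_pos, by simp⟩
  · obtain ⟨i, hi, hmin⟩ := s.exists_min_image g hs
    exact ⟨g i, hg i hi, hmin⟩

/-- Every gauge admits a fine partition whose Riemann sum approximates the integral, and which is
compatible with every additive function of the end points. -/
theorem HasStrongMcShaneIntegral.exists_fine_approx {a b : ℝ} (hab : a < b) {g : ℝ → X} {u : X}
    (hg : HasStrongMcShaneIntegral a b g u) {δ : ℝ → ℝ} (hδ : IsGauge (Set.Icc a b) δ) {ε : ℝ}
    (hε : 0 < ε) :
    ∃ P : Finset (ℝ × ℝ × ℝ), IsMPartition (Set.Icc a b) P ∧ IsFine δ P ∧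
      (∀ φ : ℝ × ℝ → X, (∀ p q r, a ≤ p → p < q → q < r → r ≤ b → φ (p, r) = φ (p, q) + φ (q, r)) →
        ∑ x ∈ P, φ x.2 = φ (a, b)) ∧
      ‖(∑ x ∈ P, (volume (itemBox x)).toReal • g x.1) - u‖ < ε := by
  obtain ⟨H, hH, rfl, hlim⟩ := hg
  obtain ⟨γ, hγ, hγP⟩ := hlim ε hε
  obtain ⟨P, hP, hfine, hadd⟩ := exists_fine_mPartition (G := X) hab
    (δ := fun s => min (δ s) (γ s)) fun s hs => lt_min (hδ s hs) (hγ s hs)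
  refine ⟨P, hP, fun x hx => (hfine x hx).trans (Metric.ball_subset_ball (min_le_left _ _)), hadd,
    lt_of_le_of_lt ?_ (hγP P hP fun x hx =>
      (hfine x hx).trans (Metric.ball_subset_ball (min_le_right _ _)))⟩
  rw [← hadd H fun p q r hp hpq hqr hr => hH.add_adjacent hp hpq hqr hr,
    ← Finset.sum_sub_distrib]
  exact norm_sum_le _ _

/-- Lemma 2.2(ii) for the McShane integral:
if `f` is strongly integrable on `[a,b]` with integral `v` and all sections are strongly
integrable, then the iterated integral of the sections is strongly integrable with integral `v`. -/
theorem fubini_strong_mcShane_snd {X : Type*} [NormedAddCommGroup X] [NormedSpace ℝ X] [CompleteSpace X] (a₁ b₁ a₂ b₂ : ℝ) (hab₁ : a₁ < b₁) (hab₂ : a₂ < b₂)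
    (f : ℝ × ℝ → X) (v : X) (h : ℝ → X)
    (hf : HasStrongMcShaneIntegral ((a₁, a₂) : ℝ × ℝ) (b₁, b₂) f v)
    (hh : ∀ t₂ ∈ Set.Icc a₂ b₂, HasStrongMcShaneIntegral a₁ b₁ (fun s₁ => f (s₁, t₂)) (h t₂))
    (hsec : ∀ t₁ ∈ Set.Icc a₁ b₁, ∃ u : X, HasStrongMcShaneIntegral a₂ b₂ (fun s₂ => f (t₁, s₂)) u) :
    HasStrongMcShaneIntegral a₂ b₂ h v := by
  classical
  obtain ⟨F, hF, rfl, hlim⟩ := hf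
  refine ⟨_, hF.strip hab₁, rfl, fun ε hε => ?_⟩
  have hpos : 0 < 1 + (b₂ - a₂) := by linarith
  set ε' := ε / (1 + (b₂ - a₂)) with hε'
  have hε'pos : 0 < ε' := div_pos hε hpos
  obtain ⟨δ, hδ, hδP⟩ := hlim ε' hε'pos
  have hδt : ∀ t ∈ Set.Icc a₂ b₂, IsGauge (Set.Icc a₁ b₁) (fun s => δ (s, t)) :=
    fun t ht s hs => hδ (s, t) (by rw [Set.Icc_prod_eq]; exact ⟨hs, ht⟩)
  choose! P hPpart hPfine hPadd hPapprox using fun t ht =>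
    (hh t ht).exists_fine_approx hab₁ (hδt t ht) hε'pos
  choose! η hηpos hη using fun t (ht : t ∈ Set.Icc a₂ b₂) =>
    (P t).exists_pos_forall_le (fun x => δ (x.1, t))
      fun x hx => hδt t ht _ ((hPpart t ht).1 x hx).1
  refine ⟨η, hηpos, fun Q hQ hQfine => ?_⟩
  have htag : ∀ y ∈ Q, y.1 ∈ Set.Icc a₂ b₂ := fun y hy => (hQ.1 y hy).1
  have hR := hδP _
    (IsMPartition.sigma (a := (a₁, a₂)) (b := (b₁, b₂)) (P := fun y => P y.1) hQ
      fun y hy => hPpart _ (htag y hy))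
    (hQfine.sigma (fun y hy => hPfine _ (htag y hy)) fun y hy => hη _ (htag y hy))
  rw [Finset.sum_image itemProd_injective.injOn, Finset.sum_sigma] at hR
  have hterm : ∀ y ∈ Q,
      ‖(volume (itemBox y)).toReal • h y.1 - F ((a₁, y.2.1), (b₁, y.2.2))‖ ≤
        ∑ x ∈ P y.1, ‖(volume (itemBox (itemProd ⟨y, x⟩))).toReal • f (itemProd ⟨y, x⟩).1 -
          F ((itemProd ⟨y, x⟩).2.1, (itemProd ⟨y, x⟩).2.2)‖ +
        (volume (itemBox y)).toReal * ε' := by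
    intro y hy
    have hF₁ : ∑ x ∈ P y.1, F ((x.2.1, y.2.1), (x.2.2, y.2.2)) = F ((a₁, y.2.1), (b₁, y.2.2)) :=
      hPadd _ (htag y hy) (fun I => F ((I.1, y.2.1), (I.2, y.2.2)))
        fun p q r hp hpq hqr hr => hF.add_adjacent_fst (hQ.1 y hy).2 hp hpq hqr hr
    have hsplit : (volume (itemBox y)).toReal • h y.1 - F ((a₁, y.2.1), (b₁, y.2.2)) =
        ∑ x ∈ P y.1, ((volume (itemBox (itemProd ⟨y, x⟩))).toReal • f (itemProd ⟨y, x⟩).1 -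
          F ((itemProd ⟨y, x⟩).2.1, (itemProd ⟨y, x⟩).2.2)) -
        (volume (itemBox y)).toReal •
          ((∑ x ∈ P y.1, (volume (itemBox x)).toReal • f (x.1, y.1)) - h y.1) := by
      rw [Finset.sum_sub_distrib, ← hF₁, smul_sub, Finset.smul_sum]
      simp only [volume_itemBox_itemProd, mul_smul]
      simp only [itemProd]
      abel
    rw [hsplit]
    refine (norm_sub_le _ _).trans (add_le_add (norm_sum_le _ _) ?_)
    rw [norm_smul, Real.norm_of_nonneg ENNReal.toReal_nonneg]
    exact mul_le_mul_of_nonneg_left (hPapprox _ (htag y hy)).le ENNReal.toReal_nonneg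
  refine (Finset.sum_le_sum hterm).trans_lt ?_
  rw [Finset.sum_add_distrib, ← Finset.sum_mul]
  calc _ < ε' + (b₂ - a₂) * ε' := add_lt_add_of_lt_of_le hR
        (mul_le_mul_of_nonneg_right (hQ.sum_volume_le hab₂.le) hε'pos.le)
    _ = ε := by rw [hε']; field_simp
end

section
/- Let f : [a,b] → X have the property S*M on [a,b] and let Z₁ = { t₁ ∈ [a₁,b₁] : the section f_{t₁} does not have the property S*M on [a₂,b₂] }. Then the indicator function 𝟙_{Z₁} is McShane integrable on [a₁,b₁] with (M)∫_{[a₁,b₁]} 𝟙_{Z₁} = 0. -/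
open Set MeasureTheory

variable {E : Type*} [MeasureSpace E] [PseudoMetricSpace E] [Preorder E]
variable {X : Type*} [NormedAddCommGroup X] [NormedSpace ℝ X]

/-- A cover of `[u 0, u N]` by consecutive intervals of a monotone sequence. -/
theorem biUnion_range_Icc_succ {u : ℕ → ℝ} (hu : Monotone u) {N : ℕ} (hN : 0 < N) :
    (⋃ i ∈ Finset.range N, Set.Icc (u i) (u (i + 1))) = Set.Icc (u 0) (u N) := by
  induction N, hN using Nat.le_induction with
  | base => simp
  | succ n _ ih =>
    rw [Finset.range_add_one, Finset.set_biUnion_insert, ih, Set.union_comm,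
      Set.Icc_union_Icc_eq_Icc (hu (Nat.zero_le n)) (hu (Nat.le_succ n))]

/-- Cousin's lemma for `𝓜`-partitions of a compact interval of the line. -/
theorem exists_isMPartition_isFine {p q : ℝ} (hpq : p < q) {δ : ℝ → ℝ}
    (hδ : IsGauge (Set.Icc p q) δ) :
    ∃ P : Finset (ℝ × ℝ × ℝ), IsMPartition (Set.Icc p q) P ∧ IsFine δ P := by
  obtain ⟨r, hr, hcov⟩ := lebesgue_number_lemma_of_metric (s := Set.Icc p q)
    (c := fun t : Set.Icc p q => Metric.ball (t : ℝ) (δ t)) isCompact_Icc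
    (fun _ => Metric.isOpen_ball)
    (fun x hx => Set.mem_iUnion.2 ⟨⟨x, hx⟩, Metric.mem_ball_self (hδ x hx)⟩)
  obtain ⟨N, hN⟩ := exists_nat_gt ((q - p) / r)
  have hN0 : (0 : ℝ) < N := (div_pos (sub_pos.2 hpq) hr).trans hN
  set h : ℝ := (q - p) / N with hh
  have h0 : 0 < h := div_pos (sub_pos.2 hpq) hN0
  have hhr : h < r := by
    rw [div_lt_iff₀ hr] at hN
    rw [hh, div_lt_iff₀ hN0]
    linarith
  set u : ℕ → ℝ := fun i => p + i * h with hu_def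
  have hu : StrictMono u := fun i j hij => by
    have : (i : ℝ) < j := by exact_mod_cast hij
    simp only [hu_def]
    nlinarith
  have hu0 : u 0 = p := by simp [hu_def]
  have huN : u N = q := by
    simp only [hu_def, hh]
    field_simp
    ring
  have hmem : ∀ i ∈ Finset.range N, u i ∈ Set.Icc p q := fun i hi =>
    ⟨hu0 ▸ hu.monotone (Nat.zero_le i), huN ▸ hu.monotone (Finset.mem_range.1 hi).le⟩
  have htag : ∀ i, ∃ t : ℝ, i ∈ Finset.range N →
      t ∈ Set.Icc p q ∧ Metric.ball (u i) r ⊆ Metric.ball t (δ t) := fun i => by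
    by_cases hi : i ∈ Finset.range N
    · obtain ⟨t, ht⟩ := hcov (u i) (hmem i hi)
      exact ⟨t, fun _ => ⟨t.2, ht⟩⟩
    · exact ⟨0, fun h => absurd h hi⟩
  choose t ht using htag
  refine ⟨(Finset.range N).image fun i => (t i, u i, u (i + 1)), ⟨?_, ?_, ?_⟩, ?_⟩
  · intro x hx
    obtain ⟨i, hi, rfl⟩ := Finset.mem_image.1 hx
    refine ⟨(ht i hi).1, Set.Icc_subset_Icc (hmem i hi).1 ?_, ?_⟩
    · exact huN ▸ hu.monotone (Finset.mem_range.1 hi)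
    · rw [interior_Icc]
      exact Set.nonempty_Ioo.2 (hu (Nat.lt_succ_self i))
  · intro x hx y hy hxy
    obtain ⟨i, _, rfl⟩ := Finset.mem_image.1 hx
    obtain ⟨j, _, rfl⟩ := Finset.mem_image.1 hy
    have hij : i ≠ j := fun h => hxy (by rw [h])
    refine Set.eq_empty_iff_forall_notMem.2 fun z hz => ?_
    simp only [itemBox, interior_Icc, Set.mem_inter_iff, Set.mem_Ioo] at hz
    rcases hij.lt_or_gt with hlt | hlt
    · have := hu.monotone (Nat.succ_le_of_lt hlt)
      simp only [Nat.succ_eq_add_one] at this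
      linarith [hz.1.2, hz.2.1]
    · have := hu.monotone (Nat.succ_le_of_lt hlt)
      simp only [Nat.succ_eq_add_one] at this
      linarith [hz.1.1, hz.2.2]
  · rw [Finset.set_biUnion_finset_image, ← hu0, ← huN]
    exact biUnion_range_Icc_succ hu.monotone (by exact_mod_cast hN0)
  · intro x hx
    obtain ⟨i, hi, rfl⟩ := Finset.mem_image.1 hx
    refine Set.Subset.trans (fun z hz => ?_) (ht i hi).2
    have hz' : u i ≤ z ∧ z ≤ u (i + 1) := hz
    have : u (i + 1) = u i + h := by simp only [hu_def]; push_cast; ring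
    rw [Metric.mem_ball, Real.dist_eq, abs_lt]
    constructor <;> linarith [hz'.1, hz'.2]

/-- Any fine subfamily of an `𝓜`-partition extends to a fine `𝓜`-partition. -/
theorem exists_isMPartition_isFine_superset {a b : ℝ} {δ : ℝ → ℝ}
    (hδ : IsGauge (Set.Icc a b) δ) {P P' : Finset (ℝ × ℝ × ℝ)}
    (hP : IsMPartition (Set.Icc a b) P) (hsub : P' ⊆ P) (hfine : IsFine δ P') :
    ∃ Q : Finset (ℝ × ℝ × ℝ), IsMPartition (Set.Icc a b) Q ∧ IsFine δ Q ∧ P' ⊆ Q := by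
  have hR : ∀ x, ∃ R : Finset (ℝ × ℝ × ℝ), x ∈ P →
      (∀ y ∈ R, y.1 ∈ Set.Icc a b ∧ IsSubinterval (itemBox x) y.2.1 y.2.2) ∧
      (∀ y ∈ R, ∀ z ∈ R, y ≠ z → interior (itemBox y) ∩ interior (itemBox z) = ∅) ∧
      (⋃ y ∈ R, itemBox y) = itemBox x ∧ IsFine δ R ∧ (x ∈ P' → x ∈ R) := by
    intro x
    by_cases hx : x ∈ P
    · by_cases hx' : x ∈ P'
      · refine ⟨{x}, fun _ => ⟨?_, ?_, by simp, ?_, by simp⟩⟩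
        · intro y hy
          rw [Finset.mem_singleton.1 hy]
          exact ⟨(hP.1 x hx).1, subset_rfl, (hP.1 x hx).2.2⟩
        · intro y hy z hz hyz
          exact absurd ((Finset.mem_singleton.1 hy).trans (Finset.mem_singleton.1 hz).symm) hyz
        · intro y hy
          rw [Finset.mem_singleton.1 hy]
          exact hfine x hx'
      · have hlt : x.2.1 < x.2.2 := by
          have := (hP.1 x hx).2.2
          rwa [interior_Icc, Set.nonempty_Ioo] at this
        obtain ⟨R, hR, hRf⟩ := exists_isMPartition_isFine hlt
          (fun t ht => hδ t ((hP.1 x hx).2.1 ht))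
        exact ⟨R, fun _ => ⟨fun y hy => ⟨(hP.1 x hx).2.1 (hR.1 y hy).1, (hR.1 y hy).2⟩,
          hR.2.1, hR.2.2, hRf, fun h => absurd h hx'⟩⟩
    · exact ⟨∅, fun h => absurd h hx⟩
  choose R hR using hR
  refine ⟨P.biUnion R, ⟨?_, ?_, ?_⟩, ?_, ?_⟩
  · intro y hy
    obtain ⟨x, hx, hy⟩ := Finset.mem_biUnion.1 hy
    obtain ⟨h1, h2⟩ := (hR x hx).1 y hy
    exact ⟨h1, h2.1.trans (hP.1 x hx).2.1, h2.2⟩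
  · intro y hy z hz hyz
    obtain ⟨x, hx, hy⟩ := Finset.mem_biUnion.1 hy
    obtain ⟨x', hx', hz⟩ := Finset.mem_biUnion.1 hz
    by_cases hxx : x = x'
    · subst hxx
      exact (hR x hx).2.1 y hy z hz hyz
    · refine Set.subset_eq_empty ?_ (hP.2.1 x hx x' hx' hxx)
      exact Set.inter_subset_inter (interior_mono ((hR x hx).1 y hy).2.1)
        (interior_mono ((hR x' hx').1 z hz).2.1)
  · rw [← hP.2.2, Finset.set_biUnion_biUnion]
    exact Set.iUnion₂_congr fun x hx => (hR x hx).2.2.1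
  · intro y hy
    obtain ⟨x, hx, hy⟩ := Finset.mem_biUnion.1 hy
    exact (hR x hx).2.2.2.1 y hy
  · exact fun x hx => Finset.mem_biUnion.2 ⟨x, hsub hx, (hR x (hsub hx)).2.2.2.2 hx⟩

/-- A countable union of sets with McShane-negligible indicators has an indicator with
McShane integral zero. -/
theorem hasMcShaneIntegral_indicator_iUnion {a b : ℝ} {S : ℕ → Set ℝ}
    (hS : ∀ n, ∀ ε > 0, ∃ δ : ℝ → ℝ, IsGauge (Set.Icc a b) δ ∧
      ∀ P : Finset (ℝ × ℝ × ℝ), IsMPartition (Set.Icc a b) P → IsFine δ P →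
        ∀ P' ⊆ P, (∀ x ∈ P', x.1 ∈ S n) → ∑ x ∈ P', (volume (itemBox x)).toReal < ε) :
    HasMcShaneIntegral (Set.Icc a b) ((⋃ n, S n).indicator fun _ => (1 : ℝ)) 0 := by
  classical
  intro ε hε
  obtain ⟨e, he, c, hc, hcε⟩ := posSumOfEncodable (half_pos hε) ℕ
  choose δ hδ hδS using fun n => hS n (e n) (he n)
  have hm : ∀ t : ℝ, ∃ m : ℕ, t ∈ (⋃ n, S n) → t ∈ S m := fun t => by
    by_cases ht : t ∈ ⋃ n, S n
    · obtain ⟨m, hm⟩ := Set.mem_iUnion.1 ht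
      exact ⟨m, fun _ => hm⟩
    · exact ⟨0, fun h => absurd h ht⟩
  choose m hm using hm
  refine ⟨fun t => δ (m t) t, fun t ht => hδ (m t) t ht, fun P hP hfine => ?_⟩
  have hsum : ∑ x ∈ P, (volume (itemBox x)).toReal •
      (⋃ n, S n).indicator (fun _ => (1 : ℝ)) x.1 =
      ∑ x ∈ P with x.1 ∈ ⋃ n, S n, (volume (itemBox x)).toReal := by
    rw [Finset.sum_filter]
    refine Finset.sum_congr rfl fun x _ => ?_
    by_cases hx : x.1 ∈ ⋃ n, S n <;> simp only [Set.indicator, hx, if_true, if_false,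
      smul_eq_mul, mul_one, mul_zero]
  rw [sub_zero, hsum, Real.norm_of_nonneg (Finset.sum_nonneg fun _ _ => ENNReal.toReal_nonneg)]
  set F := P.filter fun x => x.1 ∈ ⋃ n, S n
  rw [← Finset.sum_fiberwise_of_maps_to (s := F) (t := F.image fun x => m x.1)
    (g := fun x => m x.1) fun x hx => Finset.mem_image_of_mem _ hx]
  refine lt_of_le_of_lt (Finset.sum_le_sum (g := e) fun n _ => ?_)
    (((sum_le_hasSum _ (fun i _ => (he i).le) hc).trans hcε).trans_lt (half_lt_self hε))
  have hsub : (F.filter fun x => m x.1 = n) ⊆ P :=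
    (Finset.filter_subset _ _).trans (Finset.filter_subset _ _)
  obtain ⟨Q, hQ, hQf, hPQ⟩ := exists_isMPartition_isFine_superset (hδ n) hP hsub
    (fun x hx => (Finset.mem_filter.1 hx).2 ▸ hfine x (hsub hx))
  refine (hδS n Q hQ hQf _ hPQ fun x hx => ?_).le
  obtain ⟨hxF, rfl⟩ := Finset.mem_filter.1 hx
  exact hm _ (Finset.mem_filter.1 hxF).2

/-- The product of two tagged intervals. -/
def prodItem (x y : ℝ × ℝ × ℝ) : (ℝ × ℝ) × (ℝ × ℝ) × (ℝ × ℝ) :=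
  ((x.1, y.1), (x.2.1, y.2.1), (x.2.2, y.2.2))

theorem prodItem_inj {x y x' y' : ℝ × ℝ × ℝ} :
    prodItem x y = prodItem x' y' ↔ x = x' ∧ y = y' := by
  simp only [prodItem, Prod.ext_iff]
  tauto

theorem itemBox_prodItem (x y : ℝ × ℝ × ℝ) :
    itemBox (prodItem x y) = itemBox x ×ˢ itemBox y :=
  (Set.Icc_prod_Icc _ _ _ _).symm

/-- The partition of a rectangle obtained by subdividing every strip over an interval of `P`
according to a partition depending on the tag of that interval. -/
noncomputable def stripPartition (P : Finset (ℝ × ℝ × ℝ)) (R : ℝ → Finset (ℝ × ℝ × ℝ)) :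
    Finset ((ℝ × ℝ) × (ℝ × ℝ) × (ℝ × ℝ)) :=
  P.biUnion fun x => (R x.1).image (prodItem x)

theorem mem_stripPartition {P : Finset (ℝ × ℝ × ℝ)} {R : ℝ → Finset (ℝ × ℝ × ℝ)}
    {w : (ℝ × ℝ) × (ℝ × ℝ) × (ℝ × ℝ)} :
    w ∈ stripPartition P R ↔ ∃ x ∈ P, ∃ y ∈ R x.1, prodItem x y = w := by
  simp only [stripPartition, Finset.mem_biUnion, Finset.mem_image]

theorem isMPartition_stripPartition {a₁ b₁ a₂ b₂ : ℝ} {P : Finset (ℝ × ℝ × ℝ)}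
    {R : ℝ → Finset (ℝ × ℝ × ℝ)} (hP : IsMPartition (Set.Icc a₁ b₁) P)
    (hR : ∀ t ∈ Set.Icc a₁ b₁, IsMPartition (Set.Icc a₂ b₂) (R t)) :
    IsMPartition (Set.Icc ((a₁, a₂) : ℝ × ℝ) (b₁, b₂)) (stripPartition P R) := by
  refine ⟨?_, ?_, ?_⟩
  · intro w hw
    obtain ⟨x, hx, y, hy, rfl⟩ := mem_stripPartition.1 hw
    obtain ⟨hx1, hx2, hx3⟩ := hP.1 x hx
    obtain ⟨hy1, hy2, hy3⟩ := (hR _ hx1).1 y hy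
    rw [← Set.Icc_prod_Icc]
    refine ⟨⟨hx1, hy1⟩, ?_⟩
    simp only [IsSubinterval, prodItem]
    rw [← Set.Icc_prod_Icc, interior_prod_eq]
    exact ⟨Set.prod_mono hx2 hy2, hx3.prod hy3⟩
  · intro w hw w' hw' hne
    obtain ⟨x, hx, y, hy, rfl⟩ := mem_stripPartition.1 hw
    obtain ⟨x', hx', y', hy', rfl⟩ := mem_stripPartition.1 hw'
    rw [itemBox_prodItem, itemBox_prodItem, interior_prod_eq, interior_prod_eq,
      Set.prod_inter_prod]
    by_cases hxx : x = x'
    · subst hxx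
      have hyy : y ≠ y' := fun h => hne (by rw [h])
      rw [(hR _ (hP.1 x hx).1).2.1 y hy y' hy' hyy, Set.prod_empty]
    · rw [hP.2.1 x hx x' hx' hxx, Set.empty_prod]
  · rw [← Set.Icc_prod_Icc]
    ext ⟨s, t⟩
    simp only [Set.mem_iUnion, exists_prop, Set.mem_prod]
    constructor
    · rintro ⟨w, hw, hst⟩
      obtain ⟨x, hx, y, hy, rfl⟩ := mem_stripPartition.1 hw
      rw [itemBox_prodItem] at hst
      exact ⟨(hP.1 x hx).2.1 hst.1, ((hR _ (hP.1 x hx).1).1 y hy).2.1 hst.2⟩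
    · rintro ⟨hs, ht⟩
      rw [← hP.2.2] at hs
      obtain ⟨x, hx, hsx⟩ := Set.mem_iUnion₂.1 hs
      rw [← (hR _ (hP.1 x hx).1).2.2] at ht
      obtain ⟨y, hy, hty⟩ := Set.mem_iUnion₂.1 ht
      refine ⟨prodItem x y, mem_stripPartition.2 ⟨x, hx, y, hy, rfl⟩, ?_⟩
      rw [itemBox_prodItem]
      exact ⟨hsx, hty⟩

theorem isFine_stripPartition {P : Finset (ℝ × ℝ × ℝ)} {R : ℝ → Finset (ℝ × ℝ × ℝ)}
    {δ : ℝ × ℝ → ℝ} {d : ℝ → ℝ} (hP : IsFine d P)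
    (hR : ∀ x ∈ P, IsFine (fun s => δ (x.1, s)) (R x.1))
    (hd : ∀ x ∈ P, ∀ y ∈ R x.1, d x.1 ≤ δ (x.1, y.1)) :
    IsFine δ (stripPartition P R) := by
  intro w hw
  obtain ⟨x, hx, y, hy, rfl⟩ := mem_stripPartition.1 hw
  rw [itemBox_prodItem]
  simp only [prodItem]
  rw [← ball_prod_same]
  exact Set.prod_mono ((hP x hx).trans (Metric.ball_subset_ball (hd x hx y hy))) (hR x hx y hy)

/-- The double sum over two strip partitions dominates the measure-weighted sum of the double
sums over the sections. -/
theorem sum_sections_le_sum_stripPartition {Y : Type*} [NormedAddCommGroup Y] (f : ℝ × ℝ → Y)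
    (P : Finset (ℝ × ℝ × ℝ)) (R T : ℝ → Finset (ℝ × ℝ × ℝ)) :
    ∑ x ∈ P, (volume (itemBox x)).toReal * ∑ y ∈ R x.1, ∑ z ∈ T x.1,
        ‖f (x.1, y.1) - f (x.1, z.1)‖ * (volume (itemBox y ∩ itemBox z)).toReal ≤
      ∑ v ∈ stripPartition P R, ∑ w ∈ stripPartition P T,
        ‖f v.1 - f w.1‖ * (volume (itemBox v ∩ itemBox w)).toReal := by
  set g : (Σ _ : ℝ × ℝ × ℝ, (ℝ × ℝ × ℝ) × (ℝ × ℝ × ℝ)) →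
      ((ℝ × ℝ) × (ℝ × ℝ) × (ℝ × ℝ)) × ((ℝ × ℝ) × (ℝ × ℝ) × (ℝ × ℝ)) :=
    fun k => (prodItem k.1 k.2.1, prodItem k.1 k.2.2) with hg
  have hinj : Function.Injective g := by
    rintro ⟨x, y, z⟩ ⟨x', y', z'⟩ h
    simp only [hg, Prod.mk.injEq, prodItem_inj] at h
    obtain ⟨⟨rfl, rfl⟩, -, rfl⟩ := h
    rfl
  rw [← Finset.sum_product']
  have hsub : (P.sigma fun x => R x.1 ×ˢ T x.1).image g ⊆
      stripPartition P R ×ˢ stripPartition P T := by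
    intro k hk
    obtain ⟨⟨x, y, z⟩, h, rfl⟩ := Finset.mem_image.1 hk
    simp only [Finset.mem_sigma, Finset.mem_product] at h
    exact Finset.mem_product.2 ⟨mem_stripPartition.2 ⟨x, h.1, y, h.2.1, rfl⟩,
      mem_stripPartition.2 ⟨x, h.1, z, h.2.2, rfl⟩⟩
  refine le_trans (le_of_eq ?_) (Finset.sum_le_sum_of_subset_of_nonneg hsub
    fun _ _ _ => mul_nonneg (norm_nonneg _) ENNReal.toReal_nonneg)
  rw [Finset.sum_image hinj.injOn, Finset.sum_sigma]
  refine Finset.sum_congr rfl fun x _ => ?_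
  rw [Finset.sum_product, Finset.mul_sum]
  refine Finset.sum_congr rfl fun y _ => ?_
  rw [Finset.mul_sum]
  refine Finset.sum_congr rfl fun z _ => ?_
  simp only [hg]
  rw [itemBox_prodItem, itemBox_prodItem, Set.prod_inter_prod, Set.inter_self,
    Measure.volume_eq_prod, Measure.prod_prod, ENNReal.toReal_mul]
  simp only [prodItem]
  ring

theorem exists_pos_forall_le_finset {ι : Type*} (s : Finset ι) {g : ι → ℝ}
    (hg : ∀ i ∈ s, 0 < g i) : ∃ d > 0, ∀ i ∈ s, d ≤ g i := by
  classical
  induction s using Finset.induction_on with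
  | empty => exact ⟨1, one_pos, by simp⟩
  | insert i s _ ih =>
    obtain ⟨d, hd, h⟩ := ih fun j hj => hg j (Finset.mem_insert_of_mem hj)
    refine ⟨min d (g i), lt_min hd (hg i (Finset.mem_insert_self i s)), fun j hj => ?_⟩
    rcases Finset.mem_insert.1 hj with rfl | hj
    · exact min_le_right _ _
    · exact (min_le_left _ _).trans (h j hj)

/-- `PropSM` at a fixed tolerance `ε`. -/
def PropSMAt {Y : Type*} [NormedAddCommGroup Y] (ε a b : ℝ) (f : ℝ → Y) : Prop :=
  ∃ δ : ℝ → ℝ, IsGauge (Set.Icc a b) δ ∧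
    ∀ P Q : Finset (ℝ × ℝ × ℝ),
      IsMPartition (Set.Icc a b) P → IsFine δ P →
      IsMPartition (Set.Icc a b) Q → IsFine δ Q →
      ∑ x ∈ P, ∑ y ∈ Q, ‖f x.1 - f y.1‖ * (volume (itemBox x ∩ itemBox y)).toReal < ε

theorem propSM_iff_forall_nat {Y : Type*} [NormedAddCommGroup Y] {a b : ℝ} {f : ℝ → Y} :
    PropSM a b f ↔ ∀ n : ℕ, PropSMAt (1 / ((n : ℝ) + 1)) a b f := by
  refine ⟨fun h n => h _ Nat.one_div_pos_of_nat, fun h ε hε => ?_⟩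
  obtain ⟨n, hn⟩ := exists_nat_one_div_lt hε
  obtain ⟨δ, hδ, h⟩ := h n
  exact ⟨δ, hδ, fun P Q hP hPf hQ hQf => (h P Q hP hPf hQ hQf).trans hn⟩

/-- The set of parameters whose section fails `PropSMAt η` is McShane-negligible. -/
theorem exists_gauge_sum_not_propSMAt_lt {Y : Type*} [NormedAddCommGroup Y]
    {a₁ b₁ a₂ b₂ : ℝ} (hab₂ : a₂ < b₂) {f : ℝ × ℝ → Y}
    (hf : PropSM ((a₁, a₂) : ℝ × ℝ) (b₁, b₂) f) {η : ℝ} (hη : 0 < η) {ε : ℝ} (hε : 0 < ε) :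
    ∃ δ : ℝ → ℝ, IsGauge (Set.Icc a₁ b₁) δ ∧
      ∀ P : Finset (ℝ × ℝ × ℝ), IsMPartition (Set.Icc a₁ b₁) P → IsFine δ P →
        ∀ P' ⊆ P, (∀ x ∈ P', ¬ PropSMAt η a₂ b₂ fun s => f (x.1, s)) →
          ∑ x ∈ P', (volume (itemBox x)).toReal < ε := by
  obtain ⟨δ, hδ, h⟩ := hf (ε * η) (mul_pos hε hη)
  have hδ' : ∀ t ∈ Set.Icc a₁ b₁, IsGauge (Set.Icc a₂ b₂) fun s => δ (t, s) := fun t ht s hs =>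
    hδ (t, s) (by rw [← Set.Icc_prod_Icc]; exact ⟨ht, hs⟩)
  have key : ∀ t, ∃ (R T : Finset (ℝ × ℝ × ℝ)) (d : ℝ), t ∈ Set.Icc a₁ b₁ →
      IsMPartition (Set.Icc a₂ b₂) R ∧ IsFine (fun s => δ (t, s)) R ∧
      IsMPartition (Set.Icc a₂ b₂) T ∧ IsFine (fun s => δ (t, s)) T ∧
      0 < d ∧ (∀ y ∈ R ∪ T, d ≤ δ (t, y.1)) ∧
      ((¬ PropSMAt η a₂ b₂ fun s => f (t, s)) → η ≤ ∑ y ∈ R, ∑ z ∈ T,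
        ‖f (t, y.1) - f (t, z.1)‖ * (volume (itemBox y ∩ itemBox z)).toReal) := by
    intro t
    by_cases ht : t ∈ Set.Icc a₁ b₁
    swap
    · exact ⟨∅, ∅, 0, fun h => absurd h ht⟩
    have hRT : ∃ R T : Finset (ℝ × ℝ × ℝ),
        IsMPartition (Set.Icc a₂ b₂) R ∧ IsFine (fun s => δ (t, s)) R ∧
        IsMPartition (Set.Icc a₂ b₂) T ∧ IsFine (fun s => δ (t, s)) T ∧
        ((¬ PropSMAt η a₂ b₂ fun s => f (t, s)) → η ≤ ∑ y ∈ R, ∑ z ∈ T,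
          ‖f (t, y.1) - f (t, z.1)‖ * (volume (itemBox y ∩ itemBox z)).toReal) := by
      by_cases hbad : PropSMAt η a₂ b₂ fun s => f (t, s)
      · obtain ⟨R, hR, hRf⟩ := exists_isMPartition_isFine hab₂ (hδ' t ht)
        exact ⟨R, R, hR, hRf, hR, hRf, fun h => absurd hbad h⟩
      · by_contra hcon
        refine hbad ⟨_, hδ' t ht, fun R T hR hRf hT hTf => ?_⟩
        by_contra hlt
        exact hcon ⟨R, T, hR, hRf, hT, hTf, fun _ => not_lt.1 hlt⟩
    obtain ⟨R, T, hR, hRf, hT, hTf, hge⟩ := hRT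
    obtain ⟨d, hd, hle⟩ := exists_pos_forall_le_finset (R ∪ T) (g := fun y => δ (t, y.1))
      fun y hy => hδ' t ht y.1 <| by
        rcases Finset.mem_union.1 hy with hy | hy
        · exact (hR.1 y hy).1
        · exact (hT.1 y hy).1
    exact ⟨R, T, d, fun _ => ⟨hR, hRf, hT, hTf, hd, hle, hge⟩⟩
  choose R T d key using key
  refine ⟨d, fun t ht => (key t ht).2.2.2.2.1, fun P hP hPf P' hsub hbad => ?_⟩
  have htag : ∀ x ∈ P, x.1 ∈ Set.Icc a₁ b₁ := fun x hx => (hP.1 x hx).1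
  have hlt := h (stripPartition P R) (stripPartition P T)
    (isMPartition_stripPartition hP fun t ht => (key t ht).1)
    (isFine_stripPartition hPf (fun x hx => (key _ (htag x hx)).2.1) fun x hx y hy =>
      (key _ (htag x hx)).2.2.2.2.2.1 y (Finset.mem_union_left _ hy))
    (isMPartition_stripPartition hP fun t ht => (key t ht).2.2.1)
    (isFine_stripPartition hPf (fun x hx => (key _ (htag x hx)).2.2.2.1) fun x hx y hy =>
      (key _ (htag x hx)).2.2.2.2.2.1 y (Finset.mem_union_right _ hy))
  refine lt_of_mul_lt_mul_right (lt_of_le_of_lt ?_ hlt) hη.le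
  refine le_trans ?_ (sum_sections_le_sum_stripPartition f P R T)
  rw [Finset.sum_mul]
  refine le_trans (Finset.sum_le_sum fun x hx => mul_le_mul_of_nonneg_left
    ((key _ (htag x (hsub hx))).2.2.2.2.2.2 (hbad x hx)) ENNReal.toReal_nonneg) ?_
  exact Finset.sum_le_sum_of_subset_of_nonneg hsub fun x _ _ =>
    mul_nonneg ENNReal.toReal_nonneg <| Finset.sum_nonneg fun _ _ => Finset.sum_nonneg fun _ _ =>
      mul_nonneg (norm_nonneg _) ENNReal.toReal_nonneg

/-- Lemma 2.3(i): the set of `t₁` whose section fails the `𝓢*` property is null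
(its indicator is integrable with integral `0`). -/
theorem indicator_badSectionsFst_mcShane_integral_zero {X : Type*} [NormedAddCommGroup X] [NormedSpace ℝ X] [CompleteSpace X] (a₁ b₁ a₂ b₂ : ℝ) (hab₁ : a₁ < b₁) (hab₂ : a₂ < b₂)
    (f : ℝ × ℝ → X) (hf : PropSM ((a₁, a₂) : ℝ × ℝ) (b₁, b₂) f)
    (Z₁ : Set ℝ) (hZ₁ : Z₁ = {t₁ : ℝ | t₁ ∈ Set.Icc a₁ b₁ ∧ ¬ PropSM a₂ b₂ (fun s₂ => f (t₁, s₂))}) :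
    HasMcShaneIntegral (Set.Icc a₁ b₁) (Z₁.indicator (fun _ => (1 : ℝ))) 0 := by
  have hZ : Z₁ = ⋃ n : ℕ, {t | t ∈ Set.Icc a₁ b₁ ∧
      ¬ PropSMAt (1 / ((n : ℝ) + 1)) a₂ b₂ fun s => f (t, s)} := by
    ext t
    simp only [hZ₁, propSM_iff_forall_nat, not_forall, Set.mem_ofPred_eq, Set.mem_iUnion,
      exists_and_left]
  rw [hZ]
  refine hasMcShaneIntegral_indicator_iUnion fun n ε hε => ?_
  obtain ⟨δ, hδ, h⟩ := exists_gauge_sum_not_propSMAt_lt hab₂ hf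
    (Nat.one_div_pos_of_nat (n := n)) hε
  exact ⟨δ, hδ, fun P hP hPf P' hsub hbad => h P hP hPf P' hsub fun x hx => (hbad x hx).2⟩
end
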